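/- Let τ ∈ ℂ with Im τ > 0 and z ∈ ℂ, and set q := e^{2πiτ}, ζ := e^{2πiz}. Assume z ∉ ℤτ + ℤ, z + 1/2 ∉ ℤτ + ℤ, 2z ∉ 2ℤτ + ℤ, and 2z + τ + 1/2 ∉ 2ℤτ + ℤ. Then g₂(ζ;q) + L(ζ;q) = M(z;τ) + T(z;τ). -/

import Mathlib

open scoped BigOperators Classical
open Filter Topology

noncomputable section

/-- finite q-Pochhammer symbol $(x;q)_n$ -/
def qPoch (x q : ℂ) (n : ℕ) : ℂ := ∏ j ∈ Finset.range n, (1 - x * q ^ j)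

/-- infinite q-Pochhammer symbol $(x;q)_\infty$ -/
def qPochInf (x q : ℂ) : ℂ := ∏' j : ℕ, (1 - x * q ^ j)

/-- $e(x) = e^{2\pi i x}$ -/
def ee (x : ℂ) : ℂ := Complex.exp (2 * Real.pi * Complex.I * x)

/-- $\zeta_n^m = e(m/n)$ -/
def zeta (m : ℤ) (n : ℕ) : ℂ := ee ((m : ℂ) / (n : ℂ))

/-- Dedekind eta -/
def eta (τ : ℂ) : ℂ := Complex.exp (Real.pi * Complex.I * τ / 12) * qPochInf (ee τ) (ee τ)

/-- Jacobi theta -/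
def theta (z τ : ℂ) : ℂ :=
  -Complex.I * Complex.exp (Real.pi * Complex.I * τ / 4) * Complex.exp (-(Real.pi * Complex.I * z))
    * qPochInf (ee τ) (ee τ) * qPochInf (ee z) (ee τ) * qPochInf ((ee z)⁻¹ * ee τ) (ee τ)

/-- universal mock theta function g₂ -/
def g2 (ζ q : ℂ) : ℂ :=
  ∑' n : ℕ, qPoch (-q) q n * q ^ (n * (n + 1) / 2) /
    (qPoch ζ q (n + 1) * qPoch (ζ⁻¹ * q) q (n + 1))

/-- universal mock theta function g₃ -/
def g3 (ζ q : ℂ) : ℂ :=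
  ∑' n : ℕ, q ^ (n * (n + 1)) / (qPoch ζ q (n + 1) * qPoch (ζ⁻¹ * q) q (n + 1))

/-- the series L -/
def Lser (ζ q : ℂ) : ℂ :=
  (1 / 2) * ∑' n : ℕ, q ^ n * qPoch (ζ⁻¹ * q) q n * qPoch ζ q n / qPoch (-q) q n

/-- the function M -/
def Mfun (z τ : ℂ) : ℂ :=
  -(Complex.I / 2) * Complex.exp (Real.pi * Complex.I * z) * theta z τ *
    g3 (-(ee z)) (ee τ) / (Complex.exp (Real.pi * Complex.I * τ / 12) * eta (2 * τ))

/-- the function T -/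
def Tfun (z τ : ℂ) : ℂ :=
  -Complex.I * eta (2 * τ) ^ 4 / (ee z * eta τ ^ 2 * theta (2 * z) (2 * τ))
  - Complex.I * eta (2 * τ) ^ 10 * theta (2 * z + 1 / 2) (2 * τ) /
      (2 * ee z ^ 2 * Complex.exp (Real.pi * Complex.I * τ / 2) * eta τ ^ 4 * eta (4 * τ) ^ 4 *
        theta (2 * z) (2 * τ) * theta (2 * z + τ + 1 / 2) (2 * τ))
  - Complex.I * eta (2 * τ) ^ 4 * theta z τ /
      (2 * Complex.exp (Real.pi * Complex.I * τ / 2) * ee z ^ 2 * eta (4 * τ) ^ 2 *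
        theta (z + 1 / 2) τ * theta (2 * z + τ + 1 / 2) (2 * τ))

/-- the function K -/
def Kfun (z τ : ℂ) : ℂ :=
  eta (2 * τ) ^ 4 / (Complex.I * ee z * eta τ ^ 2 * theta (2 * z) (2 * τ))

/-- Zwegers' μ-function -/
def mu (z₁ z₂ τ : ℂ) : ℂ :=
  Complex.exp (Real.pi * Complex.I * z₁) / theta z₂ τ *
    ∑' n : ℤ, (-(ee z₂)) ^ n * Complex.exp (Real.pi * Complex.I * (n : ℂ) * ((n : ℂ) + 1) * τ) /
      (1 - ee z₁ * (ee τ) ^ n)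

/-- the Appell–Lerch sum A -/
def appell (ζ q : ℂ) : ℂ :=
  ∑' n : ℤ, (-1 : ℂ) ^ n * q ^ ((3 * n * (n + 1)) / 2) / (1 + ζ * q ^ n)

/-- the function Θ -/
def bigTheta (z₁ z₂ z τ : ℂ) : ℂ :=
  (1 / (2 * Real.pi * Complex.I)) * deriv (fun w => theta w τ) 0 *
    theta (z₁ + z₂ + z) τ * theta z τ /
    (theta z₁ τ * theta z₂ τ * theta (z₁ + z) τ * theta (z₂ + z) τ)

/-- the function 𝔱 -/
def tfrak (z τ : ℂ) : ℂ :=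
  Kfun z τ - Complex.I * Kfun (z + 1 / 4) (τ + 1 / 2) +
    Complex.I * Complex.exp (-(Real.pi * Complex.I * τ / 2)) * bigTheta (2 * z) τ (1 / 2) (2 * τ)

/-- the second order mock theta function B -/
def mockB (q : ℂ) : ℂ :=
  ∑' n : ℕ, q ^ n * qPoch (-q) (q ^ 2) n / qPoch q (q ^ 2) (n + 1)

/-- Ramanujan's third order mock theta function f -/
def mockf (q : ℂ) : ℂ := ∑' n : ℕ, q ^ (n ^ 2) / qPoch (-q) q n ^ 2

/-- the modular form b -/
def bfun (q : ℂ) : ℂ := qPochInf q q / qPochInf (-q) q ^ 2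

/-- τ(t) = h/k + it/(2π) -/
def tauT (h k : ℕ) (t : ℝ) : ℂ := (h : ℂ) / (k : ℂ) + Complex.I * (t : ℂ) / (2 * Real.pi)

/-- q(t) = e^{2πiτ(t)} -/
def qT (h k : ℕ) (t : ℝ) : ℂ := ee (tauT h k t)

section QPochhammer

variable {x q : ℂ}

lemma summable_norm_mul_pow (x : ℂ) (hq : ‖q‖ < 1) : Summable fun j : ℕ ↦ ‖-(x * q ^ j)‖ := by
  simpa using (summable_geometric_of_lt_one (norm_nonneg q) hq).mul_left ‖x‖

lemma multipliable_qPochInf (x : ℂ) (hq : ‖q‖ < 1) :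
    Multipliable fun j : ℕ ↦ (1 - x * q ^ j) := by
  simpa [sub_eq_add_neg] using multipliable_one_add_of_summable (summable_norm_mul_pow x hq)

lemma tendsto_qPoch (x : ℂ) (hq : ‖q‖ < 1) :
    Tendsto (qPoch x q) atTop (𝓝 (qPochInf x q)) :=
  (multipliable_qPochInf x hq).hasProd.tendsto_prod_nat

lemma qPoch_zero (x q : ℂ) : qPoch x q 0 = 1 := by simp [qPoch]

lemma qPoch_succ (x q : ℂ) (n : ℕ) : qPoch x q (n + 1) = qPoch x q n * (1 - x * q ^ n) := by
  simp [qPoch, Finset.prod_range_succ]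

lemma qPoch_succ' (x q : ℂ) (n : ℕ) : qPoch x q (n + 1) = (1 - x) * qPoch (x * q) q n := by
  simp [qPoch, Finset.prod_range_succ', mul_comm, pow_succ, mul_assoc]

lemma qPoch_mul_qPochInf (x : ℂ) (hq : ‖q‖ < 1) (n : ℕ) :
    qPoch x q n * qPochInf (x * q ^ n) q = qPochInf x q := by
  have h := (multipliable_qPochInf (x * q ^ n) hq)
  have h' : Multipliable fun j : ℕ ↦ (1 - x * q ^ (j + n)) := by
    refine h.congr fun j ↦ ?_
    ring
  have := Multipliable.prod_mul_tprod_nat_mul' (f := fun j : ℕ ↦ (1 - x * q ^ j)) h'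
  rw [qPochInf, qPochInf, ← this, qPoch]
  congr 1
  exact tprod_congr fun j ↦ by ring

lemma qPochInf_eq_one_sub_mul (x : ℂ) (hq : ‖q‖ < 1) :
    qPochInf x q = (1 - x) * qPochInf (x * q) q := by
  simpa [qPoch] using (qPoch_mul_qPochInf x hq 1).symm

lemma qPochInf_zero (q : ℂ) : qPochInf 0 q = 1 := by simp [qPochInf]

lemma qPochInf_ne_zero (hq : ‖q‖ < 1) (h : ∀ j : ℕ, x * q ^ j ≠ 1) : qPochInf x q ≠ 0 := by
  have := tprod_one_add_ne_zero_of_summable (f := fun j : ℕ ↦ -(x * q ^ j))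
    (fun j ↦ by rw [← sub_eq_add_neg, sub_ne_zero]; exact (h j).symm) (summable_norm_mul_pow x hq)
  simpa [qPochInf, sub_eq_add_neg] using this

lemma mul_pow_ne_one (hq : ‖q‖ < 1) (hx : ‖x‖ < 1) (j : ℕ) : x * q ^ j ≠ 1 := by
  intro h
  have := congrArg norm h
  rw [norm_mul, norm_pow, norm_one] at this
  have h1 : ‖q‖ ^ j ≤ 1 := pow_le_one₀ (norm_nonneg q) hq.le
  nlinarith [norm_nonneg x, norm_nonneg q]

lemma qPochInf_ne_zero_of_norm_lt_one (hq : ‖q‖ < 1) (hx : ‖x‖ < 1) : qPochInf x q ≠ 0 :=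
  qPochInf_ne_zero hq (mul_pow_ne_one hq hx)

lemma qPoch_ne_zero_of_norm_lt_one (hq : ‖q‖ < 1) (hx : ‖x‖ < 1) (n : ℕ) : qPoch x q n ≠ 0 :=
  Finset.prod_ne_zero_iff.mpr fun j _ ↦ sub_ne_zero.mpr (mul_pow_ne_one hq hx j).symm

lemma qPoch_ne_zero_of_qPochInf_ne_zero (hq : ‖q‖ < 1) (h : qPochInf x q ≠ 0) (n : ℕ) :
    qPoch x q n ≠ 0 := by
  rw [← qPoch_mul_qPochInf x hq n] at h
  exact left_ne_zero_of_mul h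

lemma norm_qPoch_le {R : ℝ} (hq : ‖q‖ < 1) (hx : ‖x‖ ≤ R) (n : ℕ) :
    ‖qPoch x q n‖ ≤ Real.exp (R * (1 - ‖q‖)⁻¹) := by
  calc ‖qPoch x q n‖ ≤ ∏ j ∈ Finset.range n, (1 + ‖x‖ * ‖q‖ ^ j) := by
        rw [qPoch, norm_prod]
        refine Finset.prod_le_prod (fun _ _ ↦ norm_nonneg _) fun j _ ↦ ?_
        simpa using norm_sub_le 1 (x * q ^ j)
    _ ≤ Real.exp (∑ j ∈ Finset.range n, ‖x‖ * ‖q‖ ^ j) :=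
        Real.prod_one_add_le_exp_sum _ fun _ ↦ by positivity
    _ ≤ Real.exp (R * (1 - ‖q‖)⁻¹) := by
        rw [Real.exp_le_exp, ← Finset.mul_sum, ← tsum_geometric_of_lt_one (norm_nonneg q) hq]
        have hR : 0 ≤ R := (norm_nonneg x).trans hx
        gcongr
        exact (summable_geometric_of_lt_one (norm_nonneg q) hq).sum_le_tsum _
          fun _ _ ↦ by positivity

lemma norm_qPochInf_le {R : ℝ} (hq : ‖q‖ < 1) (hx : ‖x‖ ≤ R) :
    ‖qPochInf x q‖ ≤ Real.exp (R * (1 - ‖q‖)⁻¹) :=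
  le_of_tendsto (tendsto_qPoch x hq).norm (Eventually.of_forall (norm_qPoch_le hq hx))

lemma differentiable_qPoch (q : ℂ) (n : ℕ) : Differentiable ℂ fun x ↦ qPoch x q n := by
  unfold qPoch
  fun_prop

lemma differentiable_qPochInf (hq : ‖q‖ < 1) : Differentiable ℂ fun x ↦ qPochInf x q := by
  intro x₀
  have hs := (summable_geometric_of_lt_one (norm_nonneg q) hq).mul_left (‖x₀‖ + 1)
  have hU : IsOpen (Metric.ball (0 : ℂ) (‖x₀‖ + 1)) := Metric.isOpen_ball
  have h := Summable.hasProdLocallyUniformlyOn_nat_one_add (R := ℂ)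
    (f := fun j x ↦ -(x * q ^ j)) hU hs
    (Eventually.of_forall fun n x hx ↦ by
      rw [mem_ball_zero_iff] at hx
      rw [norm_neg, norm_mul, norm_pow]
      gcongr) (fun n ↦ by fun_prop)
  have hd := TendstoLocallyUniformlyOn.differentiableOn h
    (Eventually.of_forall fun s ↦ by
      simpa [Finset.prod_fn] using DifferentiableOn.finsetProd (fun _ _ ↦ by fun_prop)) hU
  have hm : x₀ ∈ Metric.ball (0 : ℂ) (‖x₀‖ + 1) := by simp
  simpa [qPochInf, sub_eq_add_neg] using hd.differentiableAt (hU.mem_nhds hm)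

lemma tendsto_qPochInf_pow (hq : ‖q‖ < 1) (x : ℂ) :
    Tendsto (fun n : ℕ ↦ qPochInf (x * q ^ n) q) atTop (𝓝 1) := by
  have h : Tendsto (fun n : ℕ ↦ x * q ^ n) atTop (𝓝 0) := by
    simpa using (tendsto_pow_atTop_nhds_zero_of_norm_lt_one hq).const_mul x
  have := ((differentiable_qPochInf hq).continuous.tendsto 0).comp h
  rwa [qPochInf_zero] at this

lemma norm_sq_lt_one (hq : ‖q‖ < 1) : ‖q ^ 2‖ < 1 := by
  rw [norm_pow]
  exact pow_lt_one₀ (norm_nonneg q) hq two_ne_zero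

lemma qPochInf_sq (x : ℂ) (hq : ‖q‖ < 1) :
    qPochInf (x ^ 2) (q ^ 2) = qPochInf x q * qPochInf (-x) q := by
  rw [qPochInf, qPochInf, qPochInf,
    ← (multipliable_qPochInf x hq).tprod_mul (multipliable_qPochInf (-x) hq)]
  exact tprod_congr fun j ↦ by ring

lemma qPochInf_mul_shift (x : ℂ) (hq : ‖q‖ < 1) :
    qPochInf x (q ^ 2) * qPochInf (x * q) (q ^ 2) = qPochInf x q := by
  have h1 := multipliable_qPochInf x (norm_sq_lt_one hq)
  have h2 := multipliable_qPochInf (x * q) (norm_sq_lt_one hq)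
  rw [qPochInf, qPochInf, qPochInf]
  rw [← tprod_even_mul_odd (f := fun j : ℕ ↦ (1 - x * q ^ j))]
  · congr 1 <;> exact tprod_congr fun j ↦ by ring
  · exact h1.congr fun j ↦ by ring
  · exact h2.congr fun j ↦ by ring

end QPochhammer

section TailSeries

variable {x q : ℂ} {c : ℕ → ℂ}

/-- The product $(x;q)_\infty (q/x;q)_\infty$. -/
def jTheta (x q : ℂ) : ℂ := qPochInf x q * qPochInf (x⁻¹ * q) q

lemma jTheta_mul_q (hq0 : q ≠ 0) (hq : ‖q‖ < 1) (hx : x ≠ 0) :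
    jTheta (x * q) q = -x⁻¹ * jTheta x q := by
  have h : (x * q)⁻¹ * q = x⁻¹ := by field_simp
  rw [jTheta, jTheta, h, qPochInf_eq_one_sub_mul x⁻¹ hq, qPochInf_eq_one_sub_mul x hq]
  field_simp
  ring

lemma differentiableAt_jTheta (hq : ‖q‖ < 1) (hx : x ≠ 0) :
    DifferentiableAt ℂ (fun y ↦ jTheta y q) x := by
  have h := differentiable_qPochInf hq
  have h2 : DifferentiableAt ℂ (fun y : ℂ ↦ qPochInf (y⁻¹ * q) q) x :=
    (h _).comp x ((differentiableAt_inv hx).mul_const q)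
  exact (h x).mul h2

lemma jTheta_ne_zero (hq0 : q ≠ 0) (hq : ‖q‖ < 1) (hx : ∀ k : ℤ, x ≠ q ^ k) :
    jTheta x q ≠ 0 := by
  refine mul_ne_zero (qPochInf_ne_zero hq fun j h ↦ hx (-(j : ℤ)) ?_)
    (qPochInf_ne_zero hq fun j h ↦ hx (j + 1) ?_)
  · rw [zpow_neg, zpow_natCast]
    exact eq_inv_of_mul_eq_one_left h
  · have hx0 : x ≠ 0 := by
      rintro rfl
      simp at h
    have h3 : q * q ^ j = x := by
      field_simp at h
      linear_combination h
    rw [zpow_add_one₀ hq0, zpow_natCast, ← h3]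
    ring

/-- The series $\sum_n c_n (xq^{n+1};q)_\infty (q^{n+2}/x;q)_\infty$. -/
def tailSeries (c : ℕ → ℂ) (x q : ℂ) : ℂ :=
  ∑' n : ℕ, c n * (qPochInf (x * q ^ (n + 1)) q * qPochInf (x⁻¹ * q ^ (n + 2)) q)

lemma norm_mul_pow_le (x : ℂ) (hq : ‖q‖ < 1) (n : ℕ) : ‖x * q ^ n‖ ≤ ‖x‖ := by
  rw [norm_mul, norm_pow]
  exact mul_le_of_le_one_right (norm_nonneg x) (pow_le_one₀ (norm_nonneg q) hq.le)

lemma norm_qPochInf_mul_qPochInf_le {R : ℝ} {a b : ℂ} (hq : ‖q‖ < 1) (ha : ‖a‖ ≤ R)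
    (hb : ‖b‖ ≤ R) :
    ‖qPochInf a q * qPochInf b q‖ ≤ Real.exp (R * (1 - ‖q‖)⁻¹) * Real.exp (R * (1 - ‖q‖)⁻¹) := by
  rw [norm_mul]
  exact mul_le_mul (norm_qPochInf_le hq ha) (norm_qPochInf_le hq hb) (norm_nonneg _)
    (Real.exp_pos _).le

lemma summable_tailSeries (hq : ‖q‖ < 1) (hc : Summable fun n ↦ ‖c n‖) (x y : ℂ) (k l : ℕ) :
    Summable fun n : ℕ ↦ c n * (qPochInf (x * q ^ (n + k)) q * qPochInf (y * q ^ (n + l)) q) := by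
  set R := max ‖x‖ ‖y‖
  refine .of_norm_bounded (hc.mul_right
    (Real.exp (R * (1 - ‖q‖)⁻¹) * Real.exp (R * (1 - ‖q‖)⁻¹))) fun n ↦ ?_
  rw [norm_mul]
  exact mul_le_mul_of_nonneg_left (norm_qPochInf_mul_qPochInf_le hq
    ((norm_mul_pow_le x hq _).trans (le_max_left ‖x‖ ‖y‖))
    ((norm_mul_pow_le y hq _).trans (le_max_right ‖x‖ ‖y‖))) (norm_nonneg _)

lemma differentiableAt_tailSeries (hq : ‖q‖ < 1) (hc : Summable fun n ↦ ‖c n‖) (hx : x ≠ 0) :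
    DifferentiableAt ℂ (fun y ↦ tailSeries c y q) x := by
  set R : ℝ := max (‖x‖ + 1) (‖x⁻¹‖ + 1) with hR
  let U : Set ℂ := {0}ᶜ ∩ ((fun y : ℂ ↦ ‖y‖) ⁻¹' Set.Iio R ∩ {y : ℂ | 1 < R * ‖y‖})
  have hU : IsOpen U := by
    refine isOpen_compl_singleton.inter ((isOpen_Iio.preimage continuous_norm).inter ?_)
    exact isOpen_lt continuous_const (by fun_prop)
  have hRx : ‖x‖ < R := lt_max_of_lt_left (by linarith)
  have hRx' : ‖x⁻¹‖ < R := lt_max_of_lt_right (by linarith)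
  have hxn : 0 < ‖x‖ := norm_pos_iff.mpr hx
  have hxU : x ∈ U := by
    refine ⟨hx, hRx, ?_⟩
    rw [norm_inv, inv_lt_iff_one_lt_mul₀ hxn] at hRx'
    exact hRx'
  have hd : DifferentiableOn ℂ (fun y ↦ tailSeries c y q) U := by
    refine Complex.differentiableOn_tsum_of_summable_norm (hc.mul_right
      (Real.exp (R * (1 - ‖q‖)⁻¹) * Real.exp (R * (1 - ‖q‖)⁻¹))) (fun n y hy ↦ ?_) hU
      fun n y hy ↦ ?_
    · have h := differentiable_qPochInf hq
      have h1 : DifferentiableAt ℂ (fun y : ℂ ↦ qPochInf (y * q ^ (n + 1)) q) y :=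
        (h _).comp y (differentiableAt_id.mul_const _)
      have h2 : DifferentiableAt ℂ (fun y : ℂ ↦ qPochInf (y⁻¹ * q ^ (n + 2)) q) y :=
        (h _).comp y ((differentiableAt_inv hy.1).mul_const _)
      exact ((h1.mul h2).const_mul _).differentiableWithinAt
    · rw [norm_mul]
      refine mul_le_mul_of_nonneg_left (norm_qPochInf_mul_qPochInf_le hq
        ((norm_mul_pow_le _ hq _).trans (le_of_lt hy.2.1))
        ((norm_mul_pow_le _ hq _).trans ?_)) (norm_nonneg _)
      rw [norm_inv]
      exact (inv_le_iff_one_le_mul₀ (norm_pos_iff.mpr hy.1)).mpr (le_of_lt hy.2.2)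
  exact hd.differentiableAt (hU.mem_nhds hxU)

lemma jTheta_mul_tsum_div (hq : ‖q‖ < 1) (h : jTheta x q ≠ 0) :
    jTheta x q * ∑' n : ℕ, c n / (qPoch x q (n + 1) * qPoch (x⁻¹ * q) q (n + 1)) =
      tailSeries c x q := by
  rw [← tsum_mul_left, tailSeries]
  refine tsum_congr fun n ↦ ?_
  have h1 := qPoch_ne_zero_of_qPochInf_ne_zero hq (left_ne_zero_of_mul h) (n + 1)
  have h2 := qPoch_ne_zero_of_qPochInf_ne_zero hq (right_ne_zero_of_mul h) (n + 1)
  have h3 : x⁻¹ * q ^ (n + 2) = x⁻¹ * q * q ^ (n + 1) := by ring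
  rw [jTheta, ← qPoch_mul_qPochInf x hq (n + 1), ← qPoch_mul_qPochInf (x⁻¹ * q) hq (n + 1), h3]
  generalize x⁻¹ * q = y at *
  field_simp

lemma tsum_eq_of_telescope {f u : ℕ → ℂ} {l : ℂ} (hf : Summable f)
    (h : ∀ n, f n = u n - u (n + 1)) (hu : Tendsto u atTop (𝓝 l)) : ∑' n, f n = u 0 - l := by
  refine tendsto_nhds_unique hf.hasSum.tendsto_sum_nat ?_
  simp_rw [h, Finset.sum_range_sub']
  exact hu.const_sub _

lemma tailSeries_mul_q_sub (hq0 : q ≠ 0) (hq : ‖q‖ < 1) (hc : Summable fun n ↦ ‖c n‖)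
    (hx : x ≠ 0) (s t : ℂ)
    (h : ∀ n, c n * ((1 - x⁻¹ * q ^ (n + 1)) - s * (1 - x * q ^ (n + 1))) =
      t * (c n * ((1 - x⁻¹ * q ^ (n + 1)) * (1 - x * q ^ (n + 1))) - c (n + 1))) :
    tailSeries c (x * q) q - s * tailSeries c x q =
      t * c 0 * (qPochInf (x * q) q * qPochInf (x⁻¹ * q) q) := by
  have h1 := summable_tailSeries hq hc x x⁻¹ 1 2
  have h2 : Summable fun n : ℕ ↦ c n *
      (qPochInf (x * q * q ^ (n + 1)) q * qPochInf ((x * q)⁻¹ * q ^ (n + 2)) q) :=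
    summable_tailSeries hq hc (x * q) (x * q)⁻¹ 1 2
  rw [tailSeries, tailSeries, ← tsum_mul_left, ← h2.tsum_sub (h1.mul_left s)]
  have key := tsum_eq_of_telescope (l := 0) (h2.sub (h1.mul_left s))
    (u := fun n ↦ t * c n * (qPochInf (x * q ^ (n + 1)) q * qPochInf (x⁻¹ * q ^ (n + 1)) q))
    (fun n ↦ ?_) ?_
  · simpa using key
  · have e1 : x * q * q ^ (n + 1) = x * q ^ (n + 1) * q := by ring
    have e2 : (x * q)⁻¹ * q ^ (n + 2) = x⁻¹ * q ^ (n + 1) := by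
      field_simp
      ring
    have e3 : x * q ^ (n + 1 + 1) = x * q ^ (n + 1) * q := by ring
    have e4 : x⁻¹ * q ^ (n + 2) = x⁻¹ * q ^ (n + 1) * q := by ring
    rw [e1, e2, e3, e4, qPochInf_eq_one_sub_mul (x * q ^ (n + 1)) hq,
      qPochInf_eq_one_sub_mul (x⁻¹ * q ^ (n + 1)) hq]
    linear_combination qPochInf (x * q ^ (n + 1) * q) q * qPochInf (x⁻¹ * q ^ (n + 1) * q) q * h n
  · have p1 := (tendsto_qPochInf_pow hq x).comp (tendsto_add_atTop_nat 1)
    have p2 := (tendsto_qPochInf_pow hq x⁻¹).comp (tendsto_add_atTop_nat 1)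
    simpa using (hc.of_norm.tendsto_atTop_zero.const_mul t).mul (p1.mul p2)

end TailSeries

section FunctionalEquations

variable {x q : ℂ}

lemma summable_norm_g3_coeff (hq : ‖q‖ < 1) : Summable fun n : ℕ ↦ ‖q ^ (n * (n + 1))‖ := by
  refine (summable_geometric_of_lt_one (norm_nonneg q) hq).of_nonneg_of_le
    (fun _ ↦ norm_nonneg _) fun n ↦ ?_
  rw [norm_pow]
  exact pow_le_pow_of_le_one (norm_nonneg q) hq.le (by nlinarith)

lemma le_triangular (n : ℕ) : n ≤ n * (n + 1) / 2 := by
  rw [Nat.le_div_iff_mul_le two_pos]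
  rcases n with _ | n
  · simp
  · nlinarith

lemma triangular_succ (n : ℕ) : (n + 1) * (n + 1 + 1) / 2 = n * (n + 1) / 2 + (n + 1) := by
  rw [show (n + 1) * (n + 1 + 1) = n * (n + 1) + (n + 1) * 2 by ring,
    Nat.add_mul_div_right _ _ two_pos]

lemma summable_norm_g2_coeff (hq : ‖q‖ < 1) :
    Summable fun n : ℕ ↦ ‖qPoch (-q) q n * q ^ (n * (n + 1) / 2)‖ := by
  refine ((summable_geometric_of_lt_one (norm_nonneg q) hq).mul_left
    (Real.exp (1 * (1 - ‖q‖)⁻¹))).of_nonneg_of_le (fun _ ↦ norm_nonneg _) fun n ↦ ?_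
  rw [norm_mul, norm_pow]
  exact mul_le_mul (norm_qPoch_le hq (by rw [norm_neg]; exact hq.le) n)
    (pow_le_pow_of_le_one (norm_nonneg q) hq.le (le_triangular n)) (by positivity)
    (Real.exp_pos _).le

lemma tailSeries_g3_mul_q (hq0 : q ≠ 0) (hq : ‖q‖ < 1) (hx : x ≠ 0) :
    tailSeries (fun n ↦ q ^ (n * (n + 1))) (x * q) q =
      x ^ 2 * tailSeries (fun n ↦ q ^ (n * (n + 1))) x q + (1 + x) * jTheta x q := by
  have h := tailSeries_mul_q_sub hq0 hq (summable_norm_g3_coeff hq) hx (x ^ 2) (1 - x ^ 2)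
    fun n ↦ by
      field_simp
      ring
  rw [jTheta, qPochInf_eq_one_sub_mul x hq]
  simp only [zero_mul, pow_zero] at h
  linear_combination h

lemma tailSeries_g2_mul_q (hq0 : q ≠ 0) (hq : ‖q‖ < 1) (hx : x ≠ 0) :
    tailSeries (fun n ↦ qPoch (-q) q n * q ^ (n * (n + 1) / 2)) (x * q) q =
      x * tailSeries (fun n ↦ qPoch (-q) q n * q ^ (n * (n + 1) / 2)) x q + jTheta x q := by
  have h := tailSeries_mul_q_sub hq0 hq (summable_norm_g2_coeff hq) hx x (1 - x)
    fun n ↦ by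
      rw [triangular_succ, pow_add, qPoch_succ]
      field_simp
      ring
  rw [jTheta, qPochInf_eq_one_sub_mul x hq]
  simp only [qPoch_zero, zero_mul, Nat.zero_div, pow_zero] at h
  linear_combination h

lemma qPochInf_neg_self_ne_zero (hq : ‖q‖ < 1) : qPochInf (-q) q ≠ 0 :=
  qPochInf_ne_zero_of_norm_lt_one hq (by rwa [norm_neg])

lemma exists_norm_inv_qPoch_le (hq : ‖q‖ < 1) : ∃ K, ∀ n, ‖(qPoch (-q) q n)⁻¹‖ ≤ K := by
  have h := (tendsto_qPoch (-q) hq).inv₀ (qPochInf_neg_self_ne_zero hq)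
  obtain ⟨K, hK⟩ := (Metric.isBounded_range_of_tendsto _ h).exists_norm_le
  exact ⟨K, fun n ↦ hK _ ⟨n, rfl⟩⟩

lemma norm_Lser_term_le {R K : ℝ} {a b : ℂ} (hq : ‖q‖ < 1)
    (hK : ∀ n, ‖(qPoch (-q) q n)⁻¹‖ ≤ K) (ha : ‖a‖ ≤ R) (hb : ‖b‖ ≤ R) (n k l : ℕ) :
    ‖q ^ n * qPoch a q k * qPoch b q l / qPoch (-q) q n‖ ≤
      ‖q‖ ^ n * (Real.exp (R * (1 - ‖q‖)⁻¹) * Real.exp (R * (1 - ‖q‖)⁻¹) * K) := by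
  rw [div_eq_mul_inv, norm_mul, norm_mul, norm_mul, norm_pow, mul_assoc (‖q‖ ^ n),
    mul_assoc (‖q‖ ^ n)]
  gcongr
  · exact norm_qPoch_le hq ha k
  · exact norm_qPoch_le hq hb l
  · exact hK n

lemma differentiableAt_Lser (hq : ‖q‖ < 1) (hx : x ≠ 0) :
    DifferentiableAt ℂ (fun y ↦ Lser y q) x := by
  obtain ⟨K, hK⟩ := exists_norm_inv_qPoch_le hq
  set R : ℝ := max ‖x‖ ‖x⁻¹ * q‖ + 1 with hR
  let U : Set ℂ := {0}ᶜ ∩ ((fun y : ℂ ↦ ‖y‖) ⁻¹' Set.Iio R ∩ {y : ℂ | ‖q‖ < R * ‖y‖})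
  have hU : IsOpen U := by
    refine isOpen_compl_singleton.inter ((isOpen_Iio.preimage continuous_norm).inter ?_)
    exact isOpen_lt continuous_const (by fun_prop)
  have hxn : 0 < ‖x‖ := norm_pos_iff.mpr hx
  have hRx : ‖x‖ < R := by linarith [le_max_left ‖x‖ ‖x⁻¹ * q‖]
  have hRx' : ‖x⁻¹ * q‖ < R := by linarith [le_max_right ‖x‖ ‖x⁻¹ * q‖]
  have hxU : x ∈ U := by
    refine ⟨hx, hRx, ?_⟩
    rwa [norm_mul, norm_inv, inv_mul_lt_iff₀ hxn, mul_comm] at hRx'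
  have hd : DifferentiableOn ℂ (fun y ↦ ∑' n : ℕ,
      q ^ n * qPoch (y⁻¹ * q) q n * qPoch y q n / qPoch (-q) q n) U := by
    refine Complex.differentiableOn_tsum_of_summable_norm
      ((summable_geometric_of_lt_one (norm_nonneg q) hq).mul_right
      (Real.exp (R * (1 - ‖q‖)⁻¹) * Real.exp (R * (1 - ‖q‖)⁻¹) * K)) (fun n y hy ↦ ?_) hU
      fun n y hy ↦ norm_Lser_term_le hq hK ?_ hy.2.1.le n n n
    · have h1 : DifferentiableAt ℂ (fun y : ℂ ↦ qPoch (y⁻¹ * q) q n) y :=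
        (differentiable_qPoch q n _).comp y ((differentiableAt_inv hy.1).mul_const _)
      exact (((h1.const_mul _).mul (differentiable_qPoch q n y)).div_const
        _).differentiableWithinAt
    · rw [norm_mul, norm_inv, inv_mul_le_iff₀ (norm_pos_iff.mpr hy.1), mul_comm]
      exact hy.2.2.le
  exact (hd.differentiableAt (hU.mem_nhds hxU)).const_mul _

lemma Lser_mul_q (hq0 : q ≠ 0) (hq : ‖q‖ < 1) (hx : x ≠ 0) :
    2 * (Lser (x * q) q + x ^ 2 * Lser x q) =
      2 * x + (1 - x) * jTheta x q / qPochInf (-q) q := by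
  obtain ⟨K, hK⟩ := exists_norm_inv_qPoch_le hq
  have hsum (y : ℂ) : Summable fun n : ℕ ↦
      q ^ n * qPoch (y⁻¹ * q) q n * qPoch y q n / qPoch (-q) q n :=
    .of_norm_bounded ((summable_geometric_of_lt_one (norm_nonneg q) hq).mul_right _)
      fun n ↦ norm_Lser_term_le hq hK (le_max_right ‖y‖ ‖y⁻¹ * q‖) (le_max_left _ _) n n n
  have h1 := hsum (x * q)
  have h2 := (hsum x).mul_left (x ^ 2)
  have h0 := qPoch_ne_zero_of_norm_lt_one hq (x := -q) (by rwa [norm_neg])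
  have key := tsum_eq_of_telescope
    (u := fun n ↦ -(1 - x) ^ 2 * (qPoch (x * q) q n * qPoch (x⁻¹ * q) q n / qPoch (-q) q n))
    ((summable_nat_add_iff 1).mpr (h1.add h2)) (fun n ↦ ?_)
    ((((tendsto_qPoch (x * q) hq).mul (tendsto_qPoch (x⁻¹ * q) hq)).div
      (tendsto_qPoch (-q) hq) (qPochInf_neg_self_ne_zero hq)).const_mul _)
  · have hz := (h1.add h2).tsum_eq_zero_add
    rw [key, h1.tsum_add h2, tsum_mul_left] at hz
    simp only [qPoch_zero, pow_zero] at hz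
    rw [Lser, Lser, jTheta, qPochInf_eq_one_sub_mul x hq]
    linear_combination hz
  · have e1 : (x * q)⁻¹ * q = x⁻¹ := by field_simp
    rw [e1, qPoch_succ' x⁻¹, qPoch_succ' x, qPoch_succ (x * q), qPoch_succ (x⁻¹ * q),
      qPoch_succ (-q)]
    have h3 := h0 n
    have h4 := h0 (n + 1)
    rw [qPoch_succ] at h4
    have h5 := right_ne_zero_of_mul h4
    generalize qPoch (x * q) q n = A
    generalize qPoch (x⁻¹ * q) q n = B
    generalize qPoch (-q) q n = C at *
    rw [pow_succ]
    generalize q ^ n = r at *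
    rw [neg_mul, sub_neg_eq_add] at h5 ⊢
    obtain ⟨E, hE⟩ : ∃ E, E = 1 + q * r := ⟨_, rfl⟩
    rw [← hE] at h5 ⊢
    field_simp
    rw [hE]
    ring

end FunctionalEquations

section DurfeeRectangle

variable {q : ℂ}

/-- The product $(q)_\infty^2$ times the generating function of partitions with a Durfee
rectangle of size $n \times (n + k)$, summed over $n$. -/
def durfeeSeries (q : ℂ) (k : ℕ) : ℂ :=
  ∑' n : ℕ, q ^ (n * (n + k)) * (qPochInf (q * q ^ n) q * qPochInf (q * q ^ (n + k)) q)

lemma qPochInf_self_mul_pow (hq : ‖q‖ < 1) (n : ℕ) :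
    qPochInf (q * q ^ n) q = (1 - q * q ^ n) * qPochInf (q * q ^ (n + 1)) q := by
  rw [qPochInf_eq_one_sub_mul _ hq, pow_succ, mul_assoc q]

lemma exists_norm_durfee_term_le (hq : ‖q‖ < 1) : ∃ K : ℝ, ∀ n k : ℕ,
    ‖q ^ (n * (n + k)) * (qPochInf (q * q ^ n) q * qPochInf (q * q ^ (n + k)) q)‖ ≤
      ‖q‖ ^ n * K := by
  refine ⟨Real.exp (‖q‖ * (1 - ‖q‖)⁻¹) * Real.exp (‖q‖ * (1 - ‖q‖)⁻¹), fun n k ↦ ?_⟩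
  rw [norm_mul, norm_pow]
  exact mul_le_mul (pow_le_pow_of_le_one (norm_nonneg q) hq.le
    ((Nat.le_mul_self n).trans (Nat.mul_le_mul_left n (Nat.le_add_right n k))))
    (norm_qPochInf_mul_qPochInf_le hq (norm_mul_pow_le q hq _) (norm_mul_pow_le q hq _))
    (norm_nonneg _) (by positivity)

lemma summable_durfee (hq : ‖q‖ < 1) (k : ℕ) : Summable fun n : ℕ ↦
    q ^ (n * (n + k)) * (qPochInf (q * q ^ n) q * qPochInf (q * q ^ (n + k)) q) := by
  obtain ⟨K, hK⟩ := exists_norm_durfee_term_le hq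
  exact .of_norm_bounded ((summable_geometric_of_lt_one (norm_nonneg q) hq).mul_right K)
    fun n ↦ hK n k

lemma durfeeSeries_sub_succ (hq : ‖q‖ < 1) (k : ℕ) :
    durfeeSeries q k - durfeeSeries q (k + 1) =
      -q ^ (k + 1) * (durfeeSeries q (k + 1) - durfeeSeries q (k + 2)) := by
  have h0 := summable_durfee hq k
  have h1 := summable_durfee hq (k + 1)
  have h2 := summable_durfee hq (k + 2)
  have hA : Tendsto (fun n : ℕ ↦ q ^ (n * (n + k)) * (qPochInf (q * q ^ n) q *
      qPochInf (q * q ^ (n + (k + 1))) q) * (1 - q ^ n)) atTop (𝓝 0) := by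
    have a1 : Tendsto (fun n : ℕ ↦ q ^ (n * (n + k))) atTop (𝓝 0) := by
      refine squeeze_zero_norm (fun n ↦ ?_)
        (tendsto_pow_atTop_nhds_zero_of_lt_one (norm_nonneg q) hq)
      rw [norm_pow]
      exact pow_le_pow_of_le_one (norm_nonneg q) hq.le
        ((Nat.le_mul_self n).trans (Nat.mul_le_mul_left n (Nat.le_add_right n k)))
    have a2 := tendsto_qPochInf_pow hq q
    have a3 := a2.comp (tendsto_add_atTop_nat (k + 1))
    have a4 := (tendsto_pow_atTop_nhds_zero_of_norm_lt_one hq).const_sub 1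
    simpa using (a1.mul (a2.mul a3)).mul a4
  have key := tsum_eq_of_telescope ((h0.sub h1).add ((h1.sub h2).mul_left (q ^ (k + 1))))
    (fun n ↦ ?_) hA
  · rw [(h0.sub h1).tsum_add ((h1.sub h2).mul_left _), tsum_mul_left, h0.tsum_sub h1,
      h1.tsum_sub h2] at key
    simp only [pow_zero, sub_self, mul_zero] at key
    rw [durfeeSeries, durfeeSeries, durfeeSeries]
    linear_combination key
  · have e1 := qPochInf_self_mul_pow hq n
    have e2 := qPochInf_self_mul_pow hq (n + k)
    have e3 := qPochInf_self_mul_pow hq (n + k + 1)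
    rw [show n + (k + 1) = n + k + 1 by ring, show n + (k + 2) = n + k + 2 by ring,
      show n + 1 + (k + 1) = n + k + 2 by ring, e1, e2, e3]
    ring

lemma durfeeSeries_eq_succ (hq : ‖q‖ < 1) (k : ℕ) :
    durfeeSeries q k = durfeeSeries q (k + 1) := by
  obtain ⟨K, hK⟩ := exists_norm_durfee_term_le hq
  have hg := (summable_geometric_of_lt_one (norm_nonneg q) hq).mul_right K
  set D : ℕ → ℂ := fun k ↦ durfeeSeries q k - durfeeSeries q (k + 1) with hD
  have hb (k : ℕ) : ‖D k‖ ≤ (∑' n : ℕ, ‖q‖ ^ n * K) + ∑' n : ℕ, ‖q‖ ^ n * K :=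
    (norm_sub_le _ _).trans (add_le_add (tsum_of_norm_bounded hg.hasSum fun n ↦ hK n k)
      (tsum_of_norm_bounded hg.hasSum fun n ↦ hK n (k + 1)))
  have hs (m : ℕ) : ‖D k‖ ≤ ‖q‖ ^ m * ‖D (k + m)‖ := by
    induction m with
    | zero => simp
    | succ m ih =>
      refine ih.trans ?_
      have h : D (k + m) = -q ^ (k + m + 1) * D (k + (m + 1)) := durfeeSeries_sub_succ hq (k + m)
      rw [h, norm_mul, norm_neg, norm_pow, pow_succ ‖q‖ m, mul_assoc]
      have : ‖q‖ ^ (k + m + 1) ≤ ‖q‖ := pow_le_of_le_one (norm_nonneg q) hq.le (by omega)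
      exact mul_le_mul_of_nonneg_left (mul_le_mul_of_nonneg_right this (norm_nonneg _))
        (by positivity)
  have hl := (tendsto_pow_atTop_nhds_zero_of_lt_one (norm_nonneg q) hq).mul_const
    ((∑' n : ℕ, ‖q‖ ^ n * K) + ∑' n : ℕ, ‖q‖ ^ n * K)
  rw [zero_mul] at hl
  have : ‖D k‖ ≤ 0 := ge_of_tendsto' hl fun m ↦
    (hs m).trans (mul_le_mul_of_nonneg_left (hb _) (by positivity))
  exact sub_eq_zero.mp (norm_le_zero_iff.mp this)

lemma tendsto_durfeeSeries (hq : ‖q‖ < 1) :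
    Tendsto (durfeeSeries q) atTop (𝓝 (qPochInf q q)) := by
  obtain ⟨K, hK⟩ := exists_norm_durfee_term_le hq
  have hg := (summable_geometric_of_lt_one (norm_nonneg q) hq).mul_right K
  have h := tendsto_tsum_of_dominated_convergence (𝓕 := atTop)
    (f := fun k n : ℕ ↦
      q ^ (n * (n + k)) * (qPochInf (q * q ^ n) q * qPochInf (q * q ^ (n + k)) q))
    (g := fun n ↦ if n = 0 then qPochInf q q else 0) hg (fun n ↦ ?_)
    (Eventually.of_forall fun k n ↦ hK n k)
  · rw [tsum_ite_eq] at h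
    exact h
  · have hw := (tendsto_qPochInf_pow hq q).comp (tendsto_add_atTop_nat n)
    rcases Nat.eq_zero_or_pos n with rfl | hn
    · simpa using (tendsto_qPochInf_pow hq q).const_mul (qPochInf q q)
    · rw [if_neg hn.ne']
      have hp : Tendsto (fun k : ℕ ↦ q ^ (n * (n + k))) atTop (𝓝 0) :=
        (tendsto_pow_atTop_nhds_zero_of_norm_lt_one hq).comp
          (tendsto_atTop_mono (fun k ↦ (Nat.le_add_left k n).trans
            (Nat.le_mul_of_pos_left _ hn)) tendsto_id)
      have := hp.mul (hw.const_mul (qPochInf (q * q ^ n) q))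
      rw [zero_mul] at this
      refine this.congr fun k ↦ ?_
      simp [add_comm]

lemma tailSeries_g3_one (hq : ‖q‖ < 1) :
    tailSeries (fun n ↦ q ^ (n * (n + 1))) 1 q = qPochInf q q := by
  have h (k : ℕ) : durfeeSeries q 1 = durfeeSeries q (k + 1) := by
    induction k with
    | zero => rfl
    | succ k ih => rw [ih, durfeeSeries_eq_succ hq]
  have hc := (tendsto_durfeeSeries hq).comp (tendsto_add_atTop_nat 1)
  have h1 : durfeeSeries q 1 = qPochInf q q :=
    tendsto_nhds_unique (tendsto_const_nhds.congr h) hc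
  rw [← h1, tailSeries, durfeeSeries]
  refine tsum_congr fun n ↦ ?_
  rw [inv_one, one_mul, one_mul, ← pow_succ', ← pow_succ']

end DurfeeRectangle

section MockIdentity

variable {x q : ℂ}

lemma apply_mul_zpow_of_invariant {f : ℂ → ℂ} (hq0 : q ≠ 0) (h : ∀ x ≠ 0, f (x * q) = f x)
    (hx : x ≠ 0) (k : ℤ) : f (x * q ^ k) = f x := by
  induction k with
  | zero => simp
  | succ k ih =>
    rw [zpow_add_one₀ hq0, ← mul_assoc, h _ (mul_ne_zero hx (zpow_ne_zero _ hq0)), ih]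
  | pred k ih =>
    rw [← ih, ← h (x * q ^ (-(k : ℤ) - 1)) (mul_ne_zero hx (zpow_ne_zero _ hq0)), mul_assoc,
      ← zpow_add_one₀ hq0, sub_add_cancel]

/-- Liouville's theorem on the torus $\mathbb{C}^\times / q^{\mathbb{Z}}$. -/
lemma eq_of_differentiable_of_invariant {f : ℂ → ℂ} (hq0 : q ≠ 0) (hq : ‖q‖ < 1)
    (hf : ∀ x ≠ 0, DifferentiableAt ℂ f x) (h : ∀ x ≠ 0, f (x * q) = f x) {x y : ℂ}
    (hx : x ≠ 0) (hy : y ≠ 0) : f x = f y := by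
  have hqn : 0 < ‖q‖ := norm_pos_iff.mpr hq0
  have hd : Differentiable ℂ (f ∘ Complex.exp) := fun w ↦
    (hf _ (Complex.exp_ne_zero w)).comp w Complex.differentiableAt_exp
  let K : Set ℂ := Metric.closedBall 0 1 ∩ {x : ℂ | ‖q‖ ≤ ‖x‖}
  have hK : IsCompact K :=
    (isCompact_closedBall 0 1).inter_right (isClosed_le continuous_const continuous_norm)
  have hfK : ContinuousOn f K := fun x hx ↦
    (hf x (norm_pos_iff.mp (hqn.trans_le hx.2))).continuousAt.continuousWithinAt
  have hb : Bornology.IsBounded (Set.range (f ∘ Complex.exp)) := by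
    refine (hK.image_of_continuousOn hfK).isBounded.subset ?_
    rintro _ ⟨w, rfl⟩
    have hw : 0 < ‖Complex.exp w‖ := norm_pos_iff.mpr (Complex.exp_ne_zero w)
    obtain ⟨n, hn1, hn2⟩ := exists_mem_Ico_zpow hw ((one_lt_inv₀ hqn).mpr hq)
    refine ⟨Complex.exp w * q ^ (n + 1), ⟨?_, ?_⟩,
      apply_mul_zpow_of_invariant hq0 h (Complex.exp_ne_zero w) _⟩
    · rw [mem_closedBall_zero_iff, norm_mul, norm_zpow]
      rw [inv_zpow, ← one_div, lt_div_iff₀ (zpow_pos hqn _)] at hn2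
      exact hn2.le
    · rw [Set.mem_ofPred_eq, norm_mul, norm_zpow, zpow_add_one₀ hqn.ne', ← mul_assoc]
      rw [inv_zpow, inv_le_iff_one_le_mul₀ (zpow_pos hqn _)] at hn1
      exact le_mul_of_one_le_left hqn.le hn1
  have := hd.apply_eq_apply_of_bounded hb (Complex.log x) (Complex.log y)
  simpa [Complex.exp_log hx, Complex.exp_log hy] using this

lemma jTheta_one (q : ℂ) (hq : ‖q‖ < 1) : jTheta 1 q = 0 := by
  rw [jTheta, qPochInf_eq_one_sub_mul 1 hq]
  simp

lemma jTheta_neg_one (q : ℂ) (hq : ‖q‖ < 1) : jTheta (-1) q = 2 * qPochInf (-q) q ^ 2 := by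
  rw [jTheta, qPochInf_eq_one_sub_mul (-1) hq]
  norm_num
  ring

lemma mock_identity (hq0 : q ≠ 0) (hq : ‖q‖ < 1) (hx : x ≠ 0) :
    (tailSeries (fun n ↦ qPoch (-q) q n * q ^ (n * (n + 1) / 2)) x q + jTheta x q * Lser x q) *
        jTheta (-x) q +
      jTheta x q ^ 2 / (2 * qPochInf (-q) q) *
        tailSeries (fun n ↦ q ^ (n * (n + 1))) (-x) q =
      2 * qPochInf (-q) q ^ 3 * qPochInf q q := by
  have hE := qPochInf_neg_self_ne_zero hq
  have h := eq_of_differentiable_of_invariant (f := fun x ↦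
    (tailSeries (fun n ↦ qPoch (-q) q n * q ^ (n * (n + 1) / 2)) x q + jTheta x q * Lser x q) *
        jTheta (-x) q +
      jTheta x q ^ 2 / (2 * qPochInf (-q) q) *
        tailSeries (fun n ↦ q ^ (n * (n + 1))) (-x) q) hq0 hq (fun y hy ↦ ?_) (fun y hy ↦ ?_) hx
    (neg_ne_zero.mpr one_ne_zero)
  · rw [h, neg_neg, jTheta_one q hq, jTheta_neg_one q hq, tailSeries_g3_one hq]
    field_simp
    ring
  · have hy' := neg_ne_zero.mpr hy
    have h1 : DifferentiableAt ℂ (fun y ↦ jTheta (-y) q) y :=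
      (differentiableAt_jTheta hq hy').comp y differentiableAt_id.neg
    have h2 : DifferentiableAt ℂ (fun y ↦ tailSeries (fun n ↦ q ^ (n * (n + 1))) (-y) q) y :=
      (differentiableAt_tailSeries hq (summable_norm_g3_coeff hq) hy').comp y
        differentiableAt_id.neg
    exact (((differentiableAt_tailSeries hq (summable_norm_g2_coeff hq) hy).add
      ((differentiableAt_jTheta hq hy).mul (differentiableAt_Lser hq hy))).mul h1).add
      ((((differentiableAt_jTheta hq hy).pow 2).div_const _).mul h2)
  · have hy' := neg_ne_zero.mpr hy
    have h1 := jTheta_mul_q hq0 hq hy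
    have h2 := jTheta_mul_q hq0 hq hy'
    have h3 := tailSeries_g2_mul_q hq0 hq hy
    have h4 := tailSeries_g3_mul_q hq0 hq hy'
    have h5 : Lser (y * q) q = y - y ^ 2 * Lser y q +
        (1 - y) * jTheta y q / (2 * qPochInf (-q) q) := by
      have := Lser_mul_q hq0 hq hy
      field_simp at this ⊢
      linear_combination this
    rw [← neg_mul, h1, h2, h3, h4, h5]
    field_simp
    ring

end MockIdentity

section CircleIntegral

variable {f g : ℂ → ℂ} {q : ℂ}

lemma circleIntegral_inv_mul_eq_norm (hf : ∀ x ≠ 0, DifferentiableAt ℂ f x) {r R : ℝ}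
    (hr : 0 < r) (hR : 0 < R) :
    ∮ z in C(0, R), z⁻¹ * f z = ∮ z in C(0, r), z⁻¹ * f z := by
  wlog h : r ≤ R generalizing r R
  · exact (this hR hr (le_of_not_ge h)).symm
  have hne {z : ℂ} (hz : z ∉ Metric.ball (0 : ℂ) r) : z ≠ 0 := by
    rintro rfl
    exact hz (Metric.mem_ball_self hr)
  simpa using Complex.circleIntegral_sub_center_inv_smul_eq_of_differentiable_on_annulus_off_countable
    hr h Set.countable_empty (f := f)
    (fun z hz ↦ (hf z (hne hz.2)).continuousAt.continuousWithinAt)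
    (fun z hz ↦ hf z (hne fun hz' ↦ hz.1.2 (Metric.ball_subset_closedBall hz')))

lemma circleIntegral_inv_mul_comp_mul (hf : ∀ x ≠ 0, DifferentiableAt ℂ f x) {c : ℂ}
    (hc : c ≠ 0) : ∮ z in C(0, 1), z⁻¹ * f (z * c) = ∮ z in C(0, 1), z⁻¹ * f z := by
  have hcn : 0 < ‖c‖ := norm_pos_iff.mpr hc
  rw [circleIntegral_inv_mul_eq_norm hf hcn one_pos]
  have hI (R : ℝ) (hR : R ≠ 0) (g : ℂ → ℂ) : ∮ z in C(0, R), z⁻¹ * g z =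
      ∫ θ in (0 : ℝ)..2 * Real.pi, Complex.I * g (circleMap 0 R θ) := by
    refine intervalIntegral.integral_congr fun θ _ ↦ ?_
    have := circleMap_ne_center hR (c := 0) (θ := θ)
    simp only [deriv_circleMap, smul_eq_mul]
    field_simp
  rw [hI 1 one_ne_zero fun z ↦ f (z * c), hI _ hcn.ne' f]
  have hper : Function.Periodic (fun θ : ℝ ↦ Complex.I * f (circleMap 0 ‖c‖ θ)) (2 * Real.pi) :=
    fun θ ↦ by simp only [periodic_circleMap 0 ‖c‖ θ]
  have hs := hper.intervalIntegral_add_eq c.arg 0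
  rw [zero_add] at hs
  have hsh := intervalIntegral.integral_comp_add_right (a := 0) (b := 2 * Real.pi)
      (fun θ ↦ Complex.I * f (circleMap 0 ‖c‖ θ)) c.arg
  rw [zero_add, add_comm _ c.arg, hs] at hsh
  rw [← hsh]
  refine intervalIntegral.integral_congr fun θ _ ↦ ?_
  have : circleMap 0 1 θ * c = circleMap 0 ‖c‖ (θ + c.arg) := by
    nth_rw 1 [← Complex.norm_mul_exp_arg_mul_I c]
    simp only [circleMap, Complex.ofReal_add, add_mul, Complex.exp_add, Complex.ofReal_one]
    ring
  simp only [this]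

lemma eq_zero_of_circleIntegral_eq_zero (hf : ∀ x ≠ 0, DifferentiableAt ℂ f x)
    (h : ∀ n : ℤ, ∮ z in C(0, 1), z⁻¹ * (z ^ n * f z) = 0) : f 1 = 0 := by
  have : Fact (0 < 2 * Real.pi) := ⟨Real.two_pi_pos⟩
  have hc : Continuous fun t : AddCircle (2 * Real.pi) ↦ f (AddCircle.toCircle t : ℂ) := by
    refine continuous_iff_continuousAt.mpr fun t ↦ ?_
    exact (hf _ (Circle.coe_ne_zero _)).continuousAt.comp
      (f := fun t : AddCircle (2 * Real.pi) ↦ (AddCircle.toCircle t : ℂ))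
      (continuous_subtype_val.comp AddCircle.continuous_toCircle).continuousAt
  let F : C(AddCircle (2 * Real.pi), ℂ) := ⟨_, hc⟩
  have hF (n : ℤ) : fourierCoeff F n = 0 := by
    rw [fourierCoeff_eq_intervalIntegral F n 0]
    have hθ (θ : ℝ) : ((AddCircle.toCircle (θ : AddCircle (2 * Real.pi)) : Circle) : ℂ) =
        circleMap 0 1 θ := by
      rw [AddCircle.toCircle_apply_mk, div_self Real.two_pi_pos.ne', one_mul, Circle.coe_exp,
        circleMap_zero, Complex.ofReal_one, one_mul]
    have hI : Complex.I * ∫ θ in (0 : ℝ)..2 * Real.pi,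
        fourier (-n) (θ : AddCircle (2 * Real.pi)) • F θ = 0 := by
      rw [← h (-n), circleIntegral, ← intervalIntegral.integral_const_mul]
      refine intervalIntegral.integral_congr fun θ _ ↦ ?_
      have h1 := circleMap_ne_center one_ne_zero (c := 0) (θ := θ)
      simp only [deriv_circleMap, fourier_apply, AddCircle.toCircle_zsmul, Circle.coe_zpow, hθ, F,
        ContinuousMap.coe_mk, smul_eq_mul]
      field_simp
    rw [zero_add, (mul_eq_zero.mp hI).resolve_left Complex.I_ne_zero, smul_zero]
  have hs : Summable (fourierCoeff F) := by
    rw [funext hF]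
    exact summable_zero
  have := has_pointwise_sum_fourier_series_of_summable hs 0
  simp only [hF, zero_smul] at this
  have h0 := this.unique hasSum_zero
  simpa [F] using h0

lemma apply_one_eq_zero_of_quasiperiodic (hq0 : q ≠ 0) (hf : ∀ x ≠ 0, DifferentiableAt ℂ f x)
    (he : ∀ x ≠ 0, f (-x) = f x) {A : ℂ} (hA : A ≠ 0)
    (h : ∀ x ≠ 0, f (x * q) = A * x⁻¹ ^ 2 * f x)
    (h0 : ∮ z in C(0, 1), z⁻¹ * f z = 0) : f 1 = 0 := by
  refine eq_zero_of_circleIntegral_eq_zero hf fun n ↦ ?_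
  have hd (n : ℤ) : ∀ x ≠ 0, DifferentiableAt ℂ (fun x ↦ x ^ n * f x) x := fun x hx ↦
    (differentiableAt_zpow.mpr (.inl hx)).mul (hf x hx)
  have hr (n : ℤ) : A * q ^ n * ∮ z in C(0, 1), z⁻¹ * (z ^ (n - 2) * f z) =
      ∮ z in C(0, 1), z⁻¹ * (z ^ n * f z) := by
    rw [← circleIntegral_inv_mul_comp_mul (hd n) hq0, ← circleIntegral.integral_const_mul]
    refine circleIntegral.integral_congr zero_le_one fun z hz ↦ ?_
    have hz0 : z ≠ 0 := ne_zero_of_mem_unit_sphere ⟨z, hz⟩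
    rw [h z hz0, mul_zpow, zpow_sub₀ hz0]
    field_simp
  have hA' (n : ℤ) : A * q ^ n ≠ 0 := mul_ne_zero hA (zpow_ne_zero n hq0)
  rcases Int.even_or_odd' n with ⟨k, rfl | rfl⟩
  · induction k with
    | zero => simpa using h0
    | succ k ih =>
      rw [← hr, mul_add, mul_one, add_sub_cancel_right, ih, mul_zero]
    | pred k ih =>
      rw [← hr] at ih
      have := (mul_eq_zero.mp ih).resolve_left (hA' _)
      rwa [mul_sub, mul_one]
  · have := circleIntegral_inv_mul_comp_mul (hd (2 * k + 1)) (neg_ne_zero.mpr one_ne_zero)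
    rw [← CharZero.neg_eq_self_iff, ← neg_one_mul, ← circleIntegral.integral_const_mul, ← this]
    refine circleIntegral.integral_congr zero_le_one fun z hz ↦ ?_
    have hz0 : z ≠ 0 := ne_zero_of_mem_unit_sphere ⟨z, hz⟩
    rw [mul_neg_one, he z hz0, Odd.neg_zpow ⟨k, rfl⟩]
    ring

lemma apply_eq_zero_of_quasiperiodic (hq0 : q ≠ 0) (hf : ∀ x ≠ 0, DifferentiableAt ℂ f x)
    (he : ∀ x ≠ 0, f (-x) = f x) {A : ℂ} (hA : A ≠ 0)
    (h : ∀ x ≠ 0, f (x * q) = A * x⁻¹ ^ 2 * f x)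
    (h0 : ∮ z in C(0, 1), z⁻¹ * f z = 0) {x : ℂ} (hx : x ≠ 0) : f x = 0 := by
  have := apply_one_eq_zero_of_quasiperiodic (f := fun z ↦ f (z * x)) hq0 (fun z hz ↦ ?_)
    (fun z hz ↦ ?_) (mul_ne_zero hA (pow_ne_zero 2 (inv_ne_zero hx))) (fun z hz ↦ ?_) ?_
  · simpa using this
  · exact (hf _ (mul_ne_zero hz hx)).comp z (differentiableAt_id.mul_const x)
  · rw [neg_mul, he _ (mul_ne_zero hz hx)]
  · rw [mul_right_comm, h _ (mul_ne_zero hz hx), mul_inv]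
    ring
  · rw [circleIntegral_inv_mul_comp_mul hf hx, h0]

/-- Even functions on $\mathbb{C}^\times$ with $f(xq) = A x^{-2} f(x)$ form a space of dimension
at most one. -/
lemma mul_eq_mul_of_quasiperiodic (hq0 : q ≠ 0) (hf : ∀ x ≠ 0, DifferentiableAt ℂ f x)
    (hfe : ∀ x ≠ 0, f (-x) = f x) (hg : ∀ x ≠ 0, DifferentiableAt ℂ g x)
    (hge : ∀ x ≠ 0, g (-x) = g x) {A : ℂ} (hA : A ≠ 0)
    (hfq : ∀ x ≠ 0, f (x * q) = A * x⁻¹ ^ 2 * f x)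
    (hgq : ∀ x ≠ 0, g (x * q) = A * x⁻¹ ^ 2 * g x) {x y : ℂ} (hx : x ≠ 0) (hy : y ≠ 0) :
    f x * g y = f y * g x := by
  set a := ∮ z in C(0, 1), z⁻¹ * f z with ha
  set b := ∮ z in C(0, 1), z⁻¹ * g z with hb
  have hi {k : ℂ → ℂ} (hk : ∀ x ≠ 0, DifferentiableAt ℂ k x) (c : ℂ) :
      CircleIntegrable (fun z ↦ c * (z⁻¹ * k z)) 0 1 :=
    ContinuousOn.circleIntegrable zero_le_one fun z hz ↦ by
      have hz0 : z ≠ 0 := ne_zero_of_mem_unit_sphere ⟨z, hz⟩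
      exact (((differentiableAt_inv hz0).mul
        (hk z hz0)).const_mul c).continuousAt.continuousWithinAt
  have key {x : ℂ} (hx : x ≠ 0) : b * f x - a * g x = 0 := by
    refine apply_eq_zero_of_quasiperiodic (f := fun x ↦ b * f x - a * g x) hq0
      (fun z hz ↦ ((hf z hz).const_mul b).sub ((hg z hz).const_mul a))
      (fun z hz ↦ by rw [hfe z hz, hge z hz]) hA
      (fun z hz ↦ by rw [hfq z hz, hgq z hz]; ring) ?_ hx
    have : ∀ z : ℂ, z⁻¹ * (b * f z - a * g z) = b * (z⁻¹ * f z) - a * (z⁻¹ * g z) :=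
      fun z ↦ by ring
    simp_rw [this]
    rw [circleIntegral.integral_sub (hi hf b) (hi hg a), circleIntegral.integral_const_mul,
      circleIntegral.integral_const_mul, ← ha, ← hb]
    ring
  by_cases hb0 : b = 0
  · by_cases ha0 : a = 0
    · rw [apply_eq_zero_of_quasiperiodic hq0 hf hfe hA hfq ha0 hx,
        apply_eq_zero_of_quasiperiodic hq0 hf hfe hA hfq ha0 hy, zero_mul, zero_mul]
    · refine mul_left_cancel₀ ha0 ?_
      linear_combination f y * key hx - f x * key hy
  · refine mul_left_cancel₀ hb0 ?_
    linear_combination g y * key hx - g x * key hy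

end CircleIntegral

section ThetaIdentity

variable {x q : ℂ}

lemma differentiableAt_jTheta_comp {u : ℂ → ℂ} (hq : ‖q‖ < 1) (hu : DifferentiableAt ℂ u x)
    (hux : u x ≠ 0) : DifferentiableAt ℂ (fun x ↦ jTheta (u x) q) x :=
  (differentiableAt_jTheta hq hux).comp x hu

lemma jTheta_sq_add_jTheta_neg_sq (hq0 : q ≠ 0) (hq : ‖q‖ < 1) (hx : x ≠ 0) :
    (jTheta x q ^ 2 + jTheta (-x) q ^ 2) * qPochInf (-q ^ 2) (q ^ 2) ^ 2 =
      2 * qPochInf (-q) q ^ 4 * jTheta (-x ^ 2) (q ^ 2) := by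
  have hq2 := norm_sq_lt_one hq
  have hd {x : ℂ} (hx : x ≠ 0) : DifferentiableAt ℂ (fun x ↦ jTheta (-x) q) x :=
    differentiableAt_jTheta_comp hq differentiableAt_id.neg (neg_ne_zero.mpr hx)
  have h := mul_eq_mul_of_quasiperiodic (f := fun x ↦ jTheta x q ^ 2 + jTheta (-x) q ^ 2)
    (g := fun x ↦ jTheta (-x ^ 2) (q ^ 2)) hq0
    (fun x hx ↦ ((differentiableAt_jTheta hq hx).pow 2).add ((hd hx).pow 2))
    (fun x hx ↦ by rw [neg_neg, add_comm])
    (fun x hx ↦ differentiableAt_jTheta_comp hq2 (by fun_prop)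
      (neg_ne_zero.mpr (pow_ne_zero 2 hx)))
    (fun x hx ↦ by rw [neg_sq]) one_ne_zero
    (fun x hx ↦ by
      rw [← neg_mul, jTheta_mul_q hq0 hq hx, jTheta_mul_q hq0 hq (neg_ne_zero.mpr hx), inv_neg]
      ring)
    (fun x hx ↦ by
      rw [mul_pow, ← neg_mul, jTheta_mul_q (pow_ne_zero 2 hq0) hq2
        (neg_ne_zero.mpr (pow_ne_zero 2 hx)), inv_neg, inv_pow]
      ring) hx one_ne_zero
  simp only [one_pow, jTheta_one q hq, jTheta_neg_one q hq, jTheta_neg_one _ hq2] at h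
  linear_combination h / 2

lemma jTheta_sq_sub_jTheta_neg_sq (hq0 : q ≠ 0) (hq : ‖q‖ < 1) (hx : x ≠ 0) :
    (jTheta x q ^ 2 - jTheta (-x) q ^ 2) * qPochInf (-q) (q ^ 2) ^ 2 =
      -4 * qPochInf (-q) q ^ 4 * x * jTheta (-x ^ 2 * q) (q ^ 2) := by
  have hq2 := norm_sq_lt_one hq
  have hd {x : ℂ} (hx : x ≠ 0) : DifferentiableAt ℂ (fun x ↦ jTheta (-x) q) x :=
    differentiableAt_jTheta_comp hq differentiableAt_id.neg (neg_ne_zero.mpr hx)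
  have hxq {x : ℂ} (hx : x ≠ 0) : -x ^ 2 * q ≠ 0 :=
    mul_ne_zero (neg_ne_zero.mpr (pow_ne_zero 2 hx)) hq0
  have h := mul_eq_mul_of_quasiperiodic
    (f := fun x ↦ x⁻¹ * (jTheta x q ^ 2 - jTheta (-x) q ^ 2))
    (g := fun x ↦ jTheta (-x ^ 2 * q) (q ^ 2)) hq0
    (fun x hx ↦ (differentiableAt_inv hx).mul
      (((differentiableAt_jTheta hq hx).pow 2).sub ((hd hx).pow 2)))
    (fun x hx ↦ by rw [neg_neg, inv_neg]; ring)
    (fun x hx ↦ differentiableAt_jTheta_comp hq2 (by fun_prop) (hxq hx))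
    (fun x hx ↦ by rw [neg_sq]) (inv_ne_zero hq0)
    (fun x hx ↦ by
      rw [← neg_mul, jTheta_mul_q hq0 hq hx, jTheta_mul_q hq0 hq (neg_ne_zero.mpr hx), inv_neg,
        mul_inv]
      ring)
    (fun x hx ↦ by
      rw [show -(x * q) ^ 2 * q = -x ^ 2 * q * q ^ 2 by ring,
        jTheta_mul_q (pow_ne_zero 2 hq0) hq2 (hxq hx)]
      field_simp) hx one_ne_zero
  have h1 : jTheta (-q) (q ^ 2) = qPochInf (-q) (q ^ 2) ^ 2 := by
    have : (-q)⁻¹ * q ^ 2 = -q := by field_simp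
    rw [jTheta, this, ← sq]
  simp only [one_pow, neg_one_mul, h1, jTheta_one q hq, jTheta_neg_one q hq] at h
  field_simp at h
  rw [neg_mul (x ^ 2)]
  linear_combination h

lemma jTheta_sq (hq0 : q ≠ 0) (hq : ‖q‖ < 1) (hx : x ≠ 0) :
    jTheta x q ^ 2 * qPochInf (-q ^ 2) (q ^ 2) ^ 2 =
      qPochInf (-q) q ^ 4 * jTheta (-x ^ 2) (q ^ 2) -
        2 * qPochInf (-q) q ^ 2 * qPochInf (-q ^ 2) (q ^ 2) ^ 4 * x *
          jTheta (-x ^ 2 * q) (q ^ 2) := by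
  have h1 := jTheta_sq_add_jTheta_neg_sq hq0 hq hx
  have h2 := jTheta_sq_sub_jTheta_neg_sq hq0 hq hx
  have h3 := qPochInf_mul_shift (-q) hq
  rw [show -q * q = -q ^ 2 by ring] at h3
  have hP := qPochInf_neg_self_ne_zero hq
  rw [← h3] at h1 h2 ⊢ hP
  have hR := left_ne_zero_of_mul hP
  refine mul_left_cancel₀ (pow_ne_zero 2 hR) ?_
  linear_combination qPochInf (-q) (q ^ 2) ^ 2 / 2 * h1 + qPochInf (-q ^ 2) (q ^ 2) ^ 2 / 2 * h2

lemma jTheta_mul_jTheta_neg (hq : ‖q‖ < 1) (x : ℂ) :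
    jTheta (x ^ 2) (q ^ 2) = jTheta x q * jTheta (-x) q := by
  rw [jTheta, jTheta, jTheta, qPochInf_sq x hq, inv_neg, neg_mul, ← inv_pow, ← mul_pow,
    qPochInf_sq _ hq]
  ring

lemma g2_add_Lser (hq0 : q ≠ 0) (hq : ‖q‖ < 1) (h1 : jTheta x q ≠ 0)
    (h2 : jTheta (-x) q ≠ 0) (hx : x ≠ 0) :
    g2 x q + Lser x q = -jTheta x q / (2 * qPochInf (-q) q) * g3 (-x) q +
      2 * qPochInf (-q) q ^ 3 * qPochInf q q / (jTheta x q * jTheta (-x) q) := by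
  have hP := qPochInf_neg_self_ne_zero hq
  have h := mock_identity hq0 hq hx
  have e2 := jTheta_mul_tsum_div hq h1 (c := fun n ↦ qPoch (-q) q n * q ^ (n * (n + 1) / 2))
  have e3 := jTheta_mul_tsum_div hq h2 (c := fun n ↦ q ^ (n * (n + 1)))
  rw [← e2, ← e3] at h
  rw [g2, g3]
  field_simp at h ⊢
  linear_combination h

end ThetaIdentity

section Specialization

variable {τ z : ℂ}

lemma ee_add (x y : ℂ) : ee (x + y) = ee x * ee y := by
  rw [ee, mul_add, Complex.exp_add, ee, ee]

lemma ee_ne_zero (x : ℂ) : ee x ≠ 0 := Complex.exp_ne_zero _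

lemma ee_natCast_mul (n : ℕ) (x : ℂ) : ee (n * x) = ee x ^ n := by
  rw [ee, ee, ← Complex.exp_nat_mul]
  ring_nf

lemma ee_half : ee (1 / 2) = -1 := by
  rw [ee, ← Complex.exp_pi_mul_I]
  ring_nf

lemma ee_eq_ee_iff {x y : ℂ} : ee x = ee y ↔ ∃ n : ℤ, x = y + n := by
  rw [ee, ee, Complex.exp_eq_exp_iff_exists_int]
  refine exists_congr fun n ↦ ?_
  have := Complex.two_pi_I_ne_zero
  rw [show 2 * Real.pi * Complex.I * y + n * (2 * Real.pi * Complex.I) =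
    2 * Real.pi * Complex.I * (y + n) by ring, mul_right_inj' this]

lemma norm_ee_lt_one (hτ : 0 < τ.im) : ‖ee τ‖ < 1 := by
  rw [ee, Complex.norm_exp, Real.exp_lt_one_iff]
  have := mul_pos Real.two_pi_pos hτ
  simpa using this

lemma ee_intCast_mul (m : ℤ) (x : ℂ) : ee (m * x) = ee x ^ m := by
  rw [ee, ee, ← Complex.exp_int_mul]
  ring_nf

lemma ee_ne_zpow (h : ¬∃ m n : ℤ, z = (m : ℂ) * τ + (n : ℂ)) (k : ℤ) : ee z ≠ ee τ ^ k := by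
  rw [← ee_intCast_mul, Ne, ee_eq_ee_iff]
  exact fun ⟨n, hn⟩ ↦ h ⟨k, n, hn⟩

lemma theta_eq (z τ : ℂ) : theta z τ = -Complex.I * Complex.exp (Real.pi * Complex.I * τ / 4) *
    Complex.exp (-(Real.pi * Complex.I * z)) * qPochInf (ee τ) (ee τ) * jTheta (ee z) (ee τ) := by
  rw [theta, jTheta]
  ring

lemma Mfun_eq (hτ : 0 < τ.im) : Mfun z τ =
    -jTheta (ee z) (ee τ) / (2 * qPochInf (-ee τ) (ee τ)) * g3 (-ee z) (ee τ) := by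
  have hq := norm_ee_lt_one hτ
  have hE := qPochInf_ne_zero_of_norm_lt_one hq hq
  have hP := qPochInf_neg_self_ne_zero hq
  have e2 : ee (2 * τ) = ee τ ^ 2 := ee_natCast_mul 2 τ
  have hs := Complex.exp_ne_zero (Real.pi * Complex.I * τ / 12)
  have hy := Complex.exp_ne_zero (Real.pi * Complex.I * z)
  have s2 : Complex.exp (Real.pi * Complex.I * (2 * τ) / 12) =
      Complex.exp (Real.pi * Complex.I * τ / 12) ^ 2 := by
    rw [← Complex.exp_nat_mul]
    ring_nf
  have s3 : Complex.exp (Real.pi * Complex.I * τ / 4) =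
      Complex.exp (Real.pi * Complex.I * τ / 12) ^ 3 := by
    rw [← Complex.exp_nat_mul]
    ring_nf
  rw [Mfun, theta_eq, eta, e2, s2, s3, qPochInf_sq _ hq, Complex.exp_neg]
  field_simp
  rw [Complex.I_sq]
  ring

lemma Tfun_eq (hτ : 0 < τ.im) (h1 : jTheta (ee z) (ee τ) ≠ 0) (h2 : jTheta (-ee z) (ee τ) ≠ 0)
    (h3 : jTheta (-ee z ^ 2 * ee τ) (ee τ ^ 2) ≠ 0) : Tfun z τ =
    2 * qPochInf (-ee τ) (ee τ) ^ 3 * qPochInf (ee τ) (ee τ) /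
      (jTheta (ee z) (ee τ) * jTheta (-ee z) (ee τ)) := by
  have hq := norm_ee_lt_one hτ
  have hE := qPochInf_ne_zero_of_norm_lt_one hq hq
  have hP := qPochInf_neg_self_ne_zero hq
  have hP2 := qPochInf_neg_self_ne_zero (norm_sq_lt_one hq)
  have key := jTheta_sq (ee_ne_zero τ) hq (ee_ne_zero z)
  have e2 : ee (2 * τ) = ee τ ^ 2 := ee_natCast_mul 2 τ
  have e4 : ee (4 * τ) = (ee τ ^ 2) ^ 2 := by
    rw [← pow_mul]
    exact ee_natCast_mul 4 τ
  have ez : ee (2 * z) = ee z ^ 2 := ee_natCast_mul 2 z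
  have ez1 : ee (z + 1 / 2) = -ee z := by rw [ee_add, ee_half, mul_neg_one]
  have ez2 : ee (2 * z + 1 / 2) = -ee z ^ 2 := by rw [ee_add, ee_half, mul_neg_one, ez]
  have ez3 : ee (2 * z + τ + 1 / 2) = -ee z ^ 2 * ee τ := by
    rw [ee_add, ee_add, ee_half, ez]
    ring
  have hs := Complex.exp_ne_zero (Real.pi * Complex.I * τ / 12)
  have hy := Complex.exp_ne_zero (Real.pi * Complex.I * z)
  have s2 : Complex.exp (Real.pi * Complex.I * (2 * τ) / 12) =
      Complex.exp (Real.pi * Complex.I * τ / 12) ^ 2 := by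
    rw [← Complex.exp_nat_mul]
    ring_nf
  have s4 : Complex.exp (Real.pi * Complex.I * (4 * τ) / 12) =
      Complex.exp (Real.pi * Complex.I * τ / 12) ^ 4 := by
    rw [← Complex.exp_nat_mul]
    ring_nf
  have s3 : Complex.exp (Real.pi * Complex.I * τ / 4) =
      Complex.exp (Real.pi * Complex.I * τ / 12) ^ 3 := by
    rw [← Complex.exp_nat_mul]
    ring_nf
  have s6 : Complex.exp (Real.pi * Complex.I * τ / 2) =
      Complex.exp (Real.pi * Complex.I * τ / 12) ^ 6 := by
    rw [← Complex.exp_nat_mul]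
    ring_nf
  have s6' : Complex.exp (Real.pi * Complex.I * (2 * τ) / 4) =
      Complex.exp (Real.pi * Complex.I * τ / 12) ^ 6 := by
    rw [← Complex.exp_nat_mul]
    ring_nf
  have yz : ee z = Complex.exp (Real.pi * Complex.I * z) ^ 2 := by
    rw [ee, ← Complex.exp_nat_mul]
    ring_nf
  have hI : Complex.exp (-(Real.pi * Complex.I * (1 / 2))) = -Complex.I := by
    rw [← Complex.exp_neg_pi_div_two_mul_I]
    ring_nf
  have y1 : Complex.exp (-(Real.pi * Complex.I * (2 * z))) = (ee z)⁻¹ := by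
    rw [ee, ← Complex.exp_neg]
    ring_nf
  have y2 : Complex.exp (-(Real.pi * Complex.I * (z + 1 / 2))) =
      (Complex.exp (Real.pi * Complex.I * z))⁻¹ * -Complex.I := by
    rw [mul_add, neg_add, Complex.exp_add, hI, Complex.exp_neg]
  have y3 : Complex.exp (-(Real.pi * Complex.I * (2 * z + 1 / 2))) = (ee z)⁻¹ * -Complex.I := by
    rw [mul_add, neg_add, Complex.exp_add, hI, y1]
  have y4 : Complex.exp (-(Real.pi * Complex.I * (2 * z + τ + 1 / 2))) =
      (ee z)⁻¹ * (Complex.exp (Real.pi * Complex.I * τ / 12) ^ 12)⁻¹ * -Complex.I := by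
    rw [mul_add, neg_add, Complex.exp_add, hI, mul_add, neg_add, Complex.exp_add, y1,
      ← Complex.exp_nat_mul, ← Complex.exp_neg]
    ring_nf
  rw [Tfun, eta, eta, eta]
  simp only [theta_eq]
  rw [e2, e4, ez, ez1, ez2, ez3, s2, s4, s3, s6, s6', y1, y2, y3, y4,
    jTheta_mul_jTheta_neg hq, qPochInf_sq _ (norm_sq_lt_one hq), qPochInf_sq _ hq, Complex.exp_neg]
  have hx := ee_ne_zero z
  generalize Complex.exp (Real.pi * Complex.I * τ / 12) = s at *
  generalize Complex.exp (Real.pi * Complex.I * z) = y at *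
  generalize jTheta (-ee z ^ 2 * ee τ) (ee τ ^ 2) = Jq at *
  generalize jTheta (-ee z ^ 2) (ee τ ^ 2) = Jm at *
  generalize jTheta (-ee z) (ee τ) = J' at *
  generalize jTheta (ee z) (ee τ) = J at *
  generalize qPochInf (-ee τ ^ 2) (ee τ ^ 2) = P2 at *
  generalize qPochInf (-ee τ) (ee τ) = P at *
  generalize qPochInf (ee τ) (ee τ) = E at *
  generalize ee z = x at *
  field_simp
  rw [Complex.I_sq]
  linear_combination key

end Specialization

/-- Lemma 2.6 (Mortenson): the bilateral series identity g₂ + L = M + T. -/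
theorem statement9 (τ z : ℂ) (hτ : 0 < τ.im)
    (hz : ¬∃ m n : ℤ, z = (m : ℂ) * τ + (n : ℂ))
    (hz2 : ¬∃ m n : ℤ, z + 1 / 2 = (m : ℂ) * τ + (n : ℂ))
    (h2z : ¬∃ m n : ℤ, 2 * z = 2 * (m : ℂ) * τ + (n : ℂ))
    (h2z2 : ¬∃ m n : ℤ, 2 * z + τ + 1 / 2 = 2 * (m : ℂ) * τ + (n : ℂ)) :
    g2 (ee z) (ee τ) + Lser (ee z) (ee τ) = Mfun z τ + Tfun z τ := by
  have hq0 := ee_ne_zero τ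
  have hq := norm_ee_lt_one hτ
  have h1 : jTheta (ee z) (ee τ) ≠ 0 := jTheta_ne_zero hq0 hq (ee_ne_zpow hz)
  have h2 : jTheta (-ee z) (ee τ) ≠ 0 := by
    refine jTheta_ne_zero hq0 hq fun k hk ↦ ee_ne_zpow hz2 k ?_
    rw [ee_add, ee_half, mul_neg_one, hk]
  have h3 : jTheta (-ee z ^ 2 * ee τ) (ee τ ^ 2) ≠ 0 := by
    refine jTheta_ne_zero (pow_ne_zero 2 hq0) (norm_sq_lt_one hq) fun k hk ↦
      ee_ne_zpow (z := 2 * z + τ + 1 / 2) (τ := 2 * τ) ?_ k ?_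
    · rintro ⟨m, n, h⟩
      exact h2z2 ⟨m, n, by rw [h]; ring⟩
    · rw [ee_add, ee_add, ee_half, show ee (2 * z) = ee z ^ 2 from ee_natCast_mul 2 z,
        show ee (2 * τ) = ee τ ^ 2 from ee_natCast_mul 2 τ, ← hk]
      ring
  rw [Mfun_eq hτ, Tfun_eq hτ h1 h2 h3, g2_add_Lser hq0 hq h1 h2 (ee_ne_zero z)]

end
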